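/- Let ℓ ≥ 4 be an integer, μ ∈ ℝ^ℓ, τ > 0, λ ∈ ℝ, and let M be a random vector in ℝ^ℓ with independent coordinates M_i ~ N(μ_i, τ²). With κ = ‖μ‖²/(2τ²), P(ℓ) = ∑_{k=0}^∞ ((ℓ−2)/(ℓ−2+2k))·κ^k e^{−κ}/k!, and Q(ℓ) = ∑_{k=0}^∞ (2κ/(ℓ−2+2k))·κ^k e^{−κ}/k!, it holds that E[1 − M'μ/‖M‖² − λτ²·M'μ/‖M‖⁴] = P(ℓ) − (λ/2)·(P(ℓ) + Q(ℓ) − 1). -/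

import Mathlib

open MeasureTheory ProbabilityTheory

/-- The law of a random vector `M` in `ℝ^ℓ` with independent coordinates
`M_i ~ N(μ_i, τ²)`: the product of the real Gaussian measures. -/
noncomputable def gaussianVecLaw (ℓ : ℕ) (μ : Fin ℓ → ℝ) (τ : ℝ) :
    Measure (Fin ℓ → ℝ) :=
  Measure.pi fun i => gaussianReal (μ i) (τ ^ 2).toNNReal

open Real Set
open scoped NNReal

theorem integrable_abs_rpow_mul_exp_neg_mul_sq {b s : ℝ} (hb : 0 < b) (hs : -1 < s) :
    Integrable fun x : ℝ => |x| ^ s * exp (-b * x ^ 2) := by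
  have hpos : IntegrableOn (fun x : ℝ => |x| ^ s * exp (-b * x ^ 2)) (Ioi 0) :=
    (integrableOn_rpow_mul_exp_neg_mul_sq hb hs).congr_fun
      (fun x hx => by simp only [abs_of_pos (mem_Ioi.1 hx)]) measurableSet_Ioi
  rw [← integrableOn_univ, ← @Iio_union_Ici _ _ (0 : ℝ), integrableOn_union,
    integrableOn_Ici_iff_integrableOn_Ioi]
  refine ⟨?_, hpos⟩
  rw [← (Measure.measurePreserving_neg (volume : Measure ℝ)).integrableOn_comp_preimage
      (Homeomorph.neg ℝ).measurableEmbedding]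
  simpa [Function.comp_def] using hpos

theorem integrable_abs_rpow_gaussianReal (μ : ℝ) {v : ℝ≥0} (hv : v ≠ 0) {s : ℝ} (hs : -1 < s) :
    Integrable (fun x : ℝ => |x| ^ s) (gaussianReal μ v) := by
  have hv0 : (0 : ℝ) < v := by positivity
  rw [gaussianReal_of_var_ne_zero _ hv, integrable_withDensity_iff (measurable_gaussianPDF μ v)
    (.of_forall fun _ => gaussianPDF_lt_top)]
  simp only [toReal_gaussianPDF]
  refine ((integrable_abs_rpow_mul_exp_neg_mul_sq (b := 1 / (4 * v)) (by positivity) hs).const_mul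
    ((√(2 * π * v))⁻¹ * exp (μ ^ 2 / (2 * v)))).mono'
    ((by fun_prop : Measurable fun x : ℝ => |x| ^ s).mul
      (measurable_gaussianPDFReal μ v)).aestronglyMeasurable (.of_forall fun x => ?_)
  rw [norm_of_nonneg (mul_nonneg (by positivity) (gaussianPDFReal_nonneg _ _ _)),
    gaussianPDFReal_def]
  have hexp : exp (-(x - μ) ^ 2 / (2 * v)) ≤
      exp (μ ^ 2 / (2 * v)) * exp (-(1 / (4 * v)) * x ^ 2) := by
    rw [← exp_add, exp_le_exp, ← sub_nonneg]
    have : μ ^ 2 / (2 * v) + -(1 / (4 * v)) * x ^ 2 - -(x - μ) ^ 2 / (2 * v)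
        = (x - 2 * μ) ^ 2 / (4 * v) := by
      field_simp
      ring
    rw [this]
    positivity
  calc |x| ^ s * ((√(2 * π * v))⁻¹ * exp (-(x - μ) ^ 2 / (2 * v)))
      ≤ |x| ^ s * ((√(2 * π * v))⁻¹ *
        (exp (μ ^ 2 / (2 * v)) * exp (-(1 / (4 * v)) * x ^ 2))) := by gcongr
    _ = _ := by ring

/-- Multiplying a Gaussian density by `exp (-t x²)` yields a multiple of another one. -/
theorem gaussianPDFReal_mul_exp_neg_mul_sq (μ : ℝ) {v s : ℝ≥0} (hv : v ≠ 0) {t : ℝ}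
    (hs : s * (1 + 2 * t * v) = 1) (x : ℝ) :
    gaussianPDFReal μ v x * exp (-(t * x ^ 2)) =
      √s * exp (-(t * μ ^ 2 * s)) * gaussianPDFReal (s * μ) (s * v) x := by
  have hv0 : (0 : ℝ) < v := by positivity
  have hs0 : (0 : ℝ) < s := lt_of_le_of_ne s.2 (by rintro h; simp [← h] at hs)
  have ht : t = (1 - s) / (2 * v * s) := by
    field_simp
    linarith
  have hroot : (√(2 * π * v))⁻¹ = √s * (√(2 * π * (s * v)))⁻¹ := by
    rw [show 2 * π * ((s : ℝ) * v) = s * (2 * π * v) by ring, sqrt_mul hs0.le]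
    have := (sqrt_pos.2 hs0).ne'
    field_simp
  have hexp : -(x - μ) ^ 2 / (2 * v) + -(t * x ^ 2) =
      -(t * μ ^ 2 * s) + -(x - s * μ) ^ 2 / (2 * (s * v)) := by
    rw [ht]
    field_simp
    ring
  simp only [gaussianPDFReal_def, NNReal.coe_mul]
  rw [hroot, mul_assoc, ← exp_add, hexp, exp_add]
  ring

theorem integral_exp_neg_mul_sq_gaussianReal (μ : ℝ) {v s : ℝ≥0} (hv : v ≠ 0) {t : ℝ}
    (hs : s * (1 + 2 * t * v) = 1) :
    ∫ x, exp (-(t * x ^ 2)) ∂gaussianReal μ v = √s * exp (-(t * μ ^ 2 * s)) := by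
  have hs0 : s ≠ 0 := by rintro rfl; simp at hs
  simp_rw [integral_gaussianReal_eq_integral_smul hv, smul_eq_mul,
    gaussianPDFReal_mul_exp_neg_mul_sq μ hv hs, integral_const_mul,
    integral_gaussianPDFReal_eq_one _ (mul_ne_zero hs0 hv), mul_one]

theorem integral_mul_exp_neg_mul_sq_gaussianReal (μ : ℝ) {v s : ℝ≥0} (hv : v ≠ 0) {t : ℝ}
    (hs : s * (1 + 2 * t * v) = 1) :
    ∫ x, x * exp (-(t * x ^ 2)) ∂gaussianReal μ v = s * μ * (√s * exp (-(t * μ ^ 2 * s))) := by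
  have hs0 : s ≠ 0 := by rintro rfl; simp at hs
  have h := integral_id_gaussianReal (μ := s * μ) (v := s * v)
  rw [integral_gaussianReal_eq_integral_smul (mul_ne_zero hs0 hv)] at h
  rw [integral_gaussianReal_eq_integral_smul hv, ← h, ← integral_mul_const]
  refine integral_congr_ae (.of_forall fun x => ?_)
  simp only [smul_eq_mul]
  rw [mul_left_comm, gaussianPDFReal_mul_exp_neg_mul_sq μ hv hs]
  ring

theorem integrable_mul_exp_neg_mul_sq_gaussianReal (μ : ℝ) (v : ℝ≥0) {t : ℝ} (ht : 0 ≤ t) :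
    Integrable (fun x => x * exp (-(t * x ^ 2))) (gaussianReal μ v) := by
  refine ((memLp_id_gaussianReal 1).integrable le_rfl).mono (by fun_prop) (.of_forall fun x => ?_)
  rw [norm_mul, norm_of_nonneg (exp_pos _).le]
  exact mul_le_of_le_one_right (norm_nonneg _) (exp_le_one_iff.2 (by simp; positivity))

theorem integrable_exp_neg_mul_sq_gaussianReal (μ : ℝ) (v : ℝ≥0) {t : ℝ} (ht : 0 ≤ t) :
    Integrable (fun x => exp (-(t * x ^ 2))) (gaussianReal μ v) := by
  refine (integrable_const (1 : ℝ)).mono (by fun_prop) (.of_forall fun x => ?_)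
  rw [norm_of_nonneg (exp_pos _).le, norm_one]
  exact exp_le_one_iff.2 (by simp; positivity)

theorem integral_pow_mul_exp_neg_mul (n : ℕ) {r : ℝ} (hr : 0 < r) :
    ∫ t in Ioi (0 : ℝ), t ^ n * exp (-(t * r)) = n.factorial / r ^ (n + 1) := by
  have h := integral_rpow_mul_exp_neg_mul_Ioi (a := n + 1) (by positivity) hr
  rw [Gamma_nat_eq_factorial, ← Nat.cast_add_one, rpow_natCast] at h
  simp only [Nat.cast_add_one, add_sub_cancel_right, rpow_natCast] at h
  simp_rw [mul_comm _ r]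
  rw [h, one_div, inv_pow]
  ring

theorem integrableOn_pow_mul_exp_neg_mul (n : ℕ) {r : ℝ} (hr : 0 < r) :
    IntegrableOn (fun t : ℝ => t ^ n * exp (-(t * r))) (Ioi 0) := by
  refine Integrable.of_integral_ne_zero ?_
  rw [integral_pow_mul_exp_neg_mul n hr]
  positivity

section Pi

variable {ι : Type*} [Fintype ι] (μ : ι → ℝ) {v : ℝ≥0}

theorem integral_sum_mul_exp_neg_mul_sum_sq_pi_gaussianReal {s : ℝ≥0} (hv : v ≠ 0) {t : ℝ}
    (ht : 0 ≤ t) (hs : s * (1 + 2 * t * v) = 1) :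
    ∫ m, (∑ i, m i * μ i) * exp (-(t * ∑ i, m i ^ 2)) ∂(Measure.pi fun i => gaussianReal (μ i) v) =
      (∑ i, μ i ^ 2) * s * (√s ^ Fintype.card ι * exp (-(t * (∑ i, μ i ^ 2) * s))) := by
  classical
  have hprod (i : ι) (m : ι → ℝ) : m i * exp (-(t * ∑ j, m j ^ 2)) =
      ∏ j, (if j = i then m j else 1) * exp (-(t * m j ^ 2)) := by
    rw [Finset.prod_mul_distrib, Finset.prod_ite_eq' Finset.univ i, ← exp_sum, Finset.mul_sum,
      Finset.sum_neg_distrib, if_pos (Finset.mem_univ i)]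
  have hint (i : ι) : Integrable (fun m : ι → ℝ => m i * exp (-(t * ∑ j, m j ^ 2)))
      (Measure.pi fun i => gaussianReal (μ i) v) := by
    simp_rw [hprod]
    refine Integrable.fintype_prod (f := fun j x => (if j = i then x else 1) * exp (-(t * x ^ 2)))
      fun j => ?_
    by_cases hj : j = i
    · simpa [hj] using integrable_mul_exp_neg_mul_sq_gaussianReal (μ i) v ht
    · simpa [hj] using integrable_exp_neg_mul_sq_gaussianReal (μ j) v ht
  have hval (i : ι) : ∫ m, m i * exp (-(t * ∑ j, m j ^ 2))
      ∂(Measure.pi fun i => gaussianReal (μ i) v) =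
      s * μ i * (√s ^ Fintype.card ι * exp (-(t * (∑ i, μ i ^ 2) * s))) := by
    simp_rw [hprod]
    rw [integral_fintype_prod_eq_prod
      (f := fun j x => (if j = i then x else 1) * exp (-(t * x ^ 2)))]
    have (j : ι) : ∫ x, (if j = i then x else 1) * exp (-(t * x ^ 2)) ∂gaussianReal (μ j) v =
        (if j = i then s * μ j else 1) * (√s * exp (-(t * μ j ^ 2 * s))) := by
      by_cases hj : j = i
      · simpa [hj] using integral_mul_exp_neg_mul_sq_gaussianReal (μ i) hv hs
      · simpa [hj] using integral_exp_neg_mul_sq_gaussianReal (μ j) hv hs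
    simp_rw [this]
    rw [Finset.prod_mul_distrib, Finset.prod_ite_eq' Finset.univ i, Finset.prod_mul_distrib,
      Finset.prod_const, Finset.card_univ, ← exp_sum, Finset.sum_neg_distrib, ← Finset.sum_mul,
      ← Finset.mul_sum, if_pos (Finset.mem_univ i)]
  simp_rw [Finset.sum_mul, mul_right_comm _ (μ _)]
  rw [integral_finsetSum _ fun i _ => (hint i).mul_const _]
  simp_rw [integral_mul_const, hval]
  exact Finset.sum_congr rfl fun i _ => by ring

theorem ae_ne_zero_pi_gaussianReal (hv : v ≠ 0) :
    ∀ᵐ m ∂(Measure.pi fun i => gaussianReal (μ i) v), ∀ i, m i ≠ 0 := by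
  rw [ae_all_iff]
  intro i
  have := nullSingletonClass_gaussianReal (μ := μ i) hv
  exact (Measure.tendsto_eval_ae_ae (μ := fun i => gaussianReal (μ i) v) (i := i)).eventually
    (Measure.ae_ne (gaussianReal (μ i) v) 0)

theorem integrable_sum_sq_rpow_pi_gaussianReal (hv : v ≠ 0) {p : ℝ} (hp : 0 ≤ p)
    (hpι : 2 * p < Fintype.card ι) :
    Integrable (fun m : ι → ℝ => (∑ i, m i ^ 2) ^ (-p))
      (Measure.pi fun i => gaussianReal (μ i) v) := by
  have hι : (0 : ℝ) < Fintype.card ι := by linarith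
  have hint : Integrable (fun m : ι → ℝ => ∏ i, |m i| ^ (-(2 * p / Fintype.card ι)))
      (Measure.pi fun i => gaussianReal (μ i) v) :=
    Integrable.fintype_prod (f := fun _ x => |x| ^ (-(2 * p / Fintype.card ι))) fun i =>
      integrable_abs_rpow_gaussianReal (μ i) hv (neg_lt_neg ((div_lt_one hι).2 hpι))
  have hmeas : Measurable fun m : ι → ℝ => (∑ i, m i ^ 2) ^ (-p) :=
    Measurable.pow_const (by fun_prop) _
  refine hint.mono' hmeas.aestronglyMeasurable ?_
  filter_upwards [ae_ne_zero_pi_gaussianReal μ hv] with m hm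
  have hS : 0 ≤ ∑ i, m i ^ 2 := Finset.sum_nonneg fun i _ => sq_nonneg _
  rw [norm_of_nonneg (by positivity)]
  calc (∑ i, m i ^ 2) ^ (-p)
      = ∏ _i : ι, √(∑ i, m i ^ 2) ^ (-(2 * p / Fintype.card ι)) := by
        rw [Finset.prod_const, Finset.card_univ, ← rpow_natCast, ← rpow_mul (sqrt_nonneg _),
          sqrt_eq_rpow, ← rpow_mul hS]
        congr 1
        field_simp
    _ ≤ _ := by
        refine Finset.prod_le_prod (fun _ _ => by positivity) fun i _ => ?_
        refine rpow_le_rpow_of_nonpos (abs_pos.2 (hm i)) ?_ (by simp; positivity)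
        exact abs_le_sqrt (Finset.single_le_sum (f := fun i => m i ^ 2)
          (fun i _ => sq_nonneg _) (Finset.mem_univ i))

theorem ae_sum_sq_pos_pi_gaussianReal [Nonempty ι] (hv : v ≠ 0) :
    ∀ᵐ m ∂(Measure.pi fun i => gaussianReal (μ i) v), 0 < ∑ i, m i ^ 2 := by
  filter_upwards [ae_ne_zero_pi_gaussianReal μ hv] with m hm
  exact Finset.sum_pos (fun i _ => by have := hm i; positivity) Finset.univ_nonempty

theorem integrable_sum_mul_div_pi_gaussianReal (hv : v ≠ 0) {n : ℕ}
    (hn : 2 * n + 1 < Fintype.card ι) :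
    Integrable (fun m : ι → ℝ => (∑ i, m i * μ i) / (∑ i, m i ^ 2) ^ (n + 1))
      (Measure.pi fun i => gaussianReal (μ i) v) := by
  have hn' : (2 * n + 1 : ℝ) < Fintype.card ι := mod_cast hn
  have : Nonempty ι := Fintype.card_pos_iff.1 (by omega)
  refine ((integrable_sum_sq_rpow_pi_gaussianReal μ hv (p := n + 1 / 2) (by positivity)
    (by linarith)).const_mul √(∑ i, μ i ^ 2)).mono' (Measurable.aestronglyMeasurable
      (by fun_prop)) ?_
  filter_upwards [ae_sum_sq_pos_pi_gaussianReal μ hv] with m hS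
  have hX : |∑ i, m i * μ i| ≤ √(∑ i, m i ^ 2) * √(∑ i, μ i ^ 2) := by
    rw [← sqrt_mul hS.le]
    exact abs_le_sqrt (Finset.sum_mul_sq_le_sq_mul_sq _ _ _)
  rw [norm_div, norm_of_nonneg (pow_pos hS _).le, norm_eq_abs]
  calc |∑ i, m i * μ i| / (∑ i, m i ^ 2) ^ (n + 1)
      ≤ √(∑ i, m i ^ 2) * √(∑ i, μ i ^ 2) / (∑ i, m i ^ 2) ^ (n + 1) := by gcongr
    _ = √(∑ i, μ i ^ 2) * ((∑ i, m i ^ 2) ^ (1 / 2 : ℝ) / (∑ i, m i ^ 2) ^ ((n + 1 : ℕ) : ℝ)) := by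
        rw [sqrt_eq_rpow (∑ i, m i ^ 2), rpow_natCast]
        ring
    _ = _ := by
        rw [← rpow_sub hS]
        congr 2
        push_cast
        ring

theorem integral_sum_mul_div_pi_gaussianReal (hv : v ≠ 0) {n : ℕ}
    (hn : 2 * n + 1 < Fintype.card ι) :
    n.factorial * ∫ m, (∑ i, m i * μ i) / (∑ i, m i ^ 2) ^ (n + 1)
        ∂(Measure.pi fun i => gaussianReal (μ i) v) =
      ∫ t in Ioi (0 : ℝ), t ^ n * ∫ m, (∑ i, m i * μ i) * exp (-(t * ∑ i, m i ^ 2))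
        ∂(Measure.pi fun i => gaussianReal (μ i) v) := by
  have : Nonempty ι := Fintype.card_pos_iff.1 (by omega)
  set P := Measure.pi fun i => gaussianReal (μ i) v
  have hpos : ∀ᵐ m ∂P, 0 < ∑ i, m i ^ 2 := ae_sum_sq_pos_pi_gaussianReal μ hv
  let f : (ι → ℝ) → ℝ → ℝ := fun m t =>
    (∑ i, m i * μ i) * (t ^ n * exp (-(t * ∑ i, m i ^ 2)))
  have hf : Integrable (Function.uncurry f) (P.prod (volume.restrict (Ioi 0))) := by
    rw [integrable_prod_iff (Measurable.aestronglyMeasurable (by unfold f; fun_prop))]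
    constructor
    · filter_upwards [hpos] with m hS
      exact (integrableOn_pow_mul_exp_neg_mul n hS).integrable.const_mul (∑ i, m i * μ i)
    · refine ((integrable_sum_mul_div_pi_gaussianReal μ hv hn).norm.const_mul
        (n.factorial : ℝ)).congr ?_
      filter_upwards [hpos] with m hS
      simp only [Function.uncurry, f, norm_mul]
      rw [integral_const_mul, setIntegral_congr_fun (g := fun t => t ^ n * exp (-(t * ∑ i, m i ^ 2)))
        measurableSet_Ioi, integral_pow_mul_exp_neg_mul n hS, norm_div,
        norm_of_nonneg (pow_pos hS _).le]
      · ring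
      · intro t ht
        have : (0 : ℝ) < t := ht
        simp only
        rw [norm_of_nonneg (by positivity), norm_of_nonneg (exp_pos _).le]
  calc _ = ∫ m, (∫ t in Ioi (0 : ℝ), f m t) ∂P := by
        rw [← integral_const_mul]
        refine integral_congr_ae ?_
        filter_upwards [hpos] with m hS
        simp only [f]
        rw [integral_const_mul, integral_pow_mul_exp_neg_mul n hS]
        ring
    _ = ∫ t in Ioi (0 : ℝ), (∫ m, f m t ∂P) := integral_integral_swap hf
    _ = _ := by simp_rw [f, mul_left_comm _ (_ ^ n), integral_const_mul]

end Pi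

theorem setIntegral_Ioi_eq_setIntegral_Ioo {c : ℝ} (hc : 0 < c) (g : ℝ → ℝ) :
    ∫ t in Ioi 0, g t = ∫ s in Ioo 0 1, (c * s ^ 2)⁻¹ * g ((1 - s) / (c * s)) := by
  have himage : (fun s : ℝ => (1 - s) / (c * s)) '' Ioo 0 1 = Ioi 0 := by
    ext t
    constructor
    · rintro ⟨s, ⟨h0, h1⟩, rfl⟩
      have : 0 < 1 - s := by linarith
      exact mem_Ioi.2 (by positivity)
    · intro ht
      have ht : 0 < t := ht
      refine ⟨1 / (1 + c * t), ⟨by positivity, ?_⟩, ?_⟩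
      · rw [div_lt_one (by positivity)]
        linarith [mul_pos hc ht]
      · field_simp
        ring
  have hderiv : ∀ s ∈ Ioo (0 : ℝ) 1,
      HasDerivWithinAt (fun s : ℝ => (1 - s) / (c * s)) (-(c * s ^ 2)⁻¹) (Ioo 0 1) s := by
    intro s hs
    have hs0 : s ≠ 0 := hs.1.ne'
    convert! (((hasDerivAt_id s).const_sub 1).div ((hasDerivAt_id s).const_mul c)
      (by simp [hc.ne', hs0])).hasDerivWithinAt using 1
    simp only [id]
    field_simp
    ring
  have hinj : InjOn (fun s : ℝ => (1 - s) / (c * s)) (Ioo 0 1) := by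
    intro a ha b hb hab
    have := ha.1.ne'
    have := hb.1.ne'
    simp only at hab
    field_simp at hab
    linarith
  rw [← himage, integral_image_eq_integral_abs_deriv_smul measurableSet_Ioo hderiv hinj]
  refine setIntegral_congr_fun measurableSet_Ioo fun s hs => ?_
  simp only [smul_eq_mul]
  rw [abs_neg, abs_of_nonneg (by have := hc.le; positivity)]

theorem integrableOn_rpow_mul_exp {a : ℝ} (ha : 0 < a) (κ : ℝ) :
    IntegrableOn (fun s : ℝ => s ^ (a - 1) * exp (-(κ * (1 - s)))) (Ioo 0 1) := by
  have h : IntegrableOn (fun s : ℝ => s ^ (a - 1)) (Icc 0 1) := by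
    rw [← intervalIntegrable_iff_integrableOn_Icc_of_le zero_le_one]
    exact intervalIntegral.intervalIntegrable_rpow' (by linarith)
  exact (h.mul_continuousOn (by fun_prop) isCompact_Icc).mono_set Ioo_subset_Icc_self

/-- The expectation of `1 / (a + K)` for a Poisson variable `K` of mean `κ`. -/
theorem hasSum_poisson_mul_inv {a κ : ℝ} (ha : 0 < a) (hκ : 0 ≤ κ) :
    HasSum (fun k : ℕ => κ ^ k * exp (-κ) / k.factorial * (a + k)⁻¹)
      (∫ s in Ioo 0 1, s ^ (a - 1) * exp (-(κ * (1 - s)))) := by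
  let F : ℕ → ℝ → ℝ := fun k s => κ ^ k * exp (-κ) / k.factorial * s ^ (a + k - 1)
  have hak (k : ℕ) : 0 < a + k := by positivity
  have hF (k : ℕ) : IntegrableOn (F k) (Ioo 0 1) := by
    refine Integrable.const_mul ?_ _
    simpa [IntegrableOn] using integrableOn_rpow_mul_exp (hak k) 0
  have hFint (k : ℕ) :
      ∫ s in Ioo 0 1, F k s = κ ^ k * exp (-κ) / k.factorial * (a + k)⁻¹ := by
    simp only [F]
    rw [integral_const_mul, ← integral_Ioc_eq_integral_Ioo,
      ← intervalIntegral.integral_of_le zero_le_one,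
      integral_rpow (Or.inl (by linarith [hak k])), one_rpow, sub_add_cancel,
      zero_rpow (hak k).ne', sub_zero, one_div]
  have hFnorm (k : ℕ) :
      ∫ s in Ioo 0 1, ‖F k s‖ = κ ^ k * exp (-κ) / k.factorial * (a + k)⁻¹ := by
    rw [← hFint]
    refine setIntegral_congr_fun measurableSet_Ioo fun s hs => norm_of_nonneg ?_
    have := hs.1.le
    positivity
  have hsum : Summable fun k : ℕ => κ ^ k * exp (-κ) / k.factorial * (a + k)⁻¹ := by
    refine Summable.of_nonneg_of_le (fun k => by positivity) (fun k => ?_)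
      ((summable_pow_div_factorial κ).mul_right (exp (-κ) * a⁻¹))
    calc κ ^ k * exp (-κ) / k.factorial * (a + k)⁻¹
        ≤ κ ^ k * exp (-κ) / k.factorial * a⁻¹ := by
          gcongr
          simp
      _ = _ := by ring
  have key := hasSum_integral_of_summable_integral_norm hF (by simpa only [hFnorm] using hsum)
  simp only [hFint] at key
  convert! key using 1
  refine setIntegral_congr_fun measurableSet_Ioo fun s hs => ?_
  have h := (NormedSpace.expSeries_div_hasSum_exp (κ * s)).mul_left (exp (-κ) * s ^ (a - 1))
  rw [← exp_eq_exp_ℝ] at h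
  refine Eq.trans ?_ (h.tsum_eq.symm.trans (tsum_congr fun k => ?_))
  · rw [show -(κ * (1 - s)) = -κ + κ * s by ring, exp_add]
    ring
  · simp only [F]
    rw [add_sub_right_comm, rpow_add_natCast hs.1.ne', mul_pow]
    ring

theorem hasSum_poisson (κ : ℝ) :
    HasSum (fun k : ℕ => κ ^ k * exp (-κ) / k.factorial) 1 := by
  have h := (NormedSpace.expSeries_div_hasSum_exp κ).mul_right (exp (-κ))
  rw [← exp_eq_exp_ℝ, ← exp_add, add_neg_cancel, exp_zero] at h
  exact h.congr_fun fun k => by ring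

/-- The recurrence that integration by parts gives for these incomplete Gamma integrals. -/
theorem poisson_inv_recurrence {a κ : ℝ} (ha : 0 < a) (hκ : 0 ≤ κ) :
    a * (∫ s in Ioo 0 1, s ^ (a - 1) * exp (-(κ * (1 - s)))) +
      κ * (∫ s in Ioo 0 1, s ^ a * exp (-(κ * (1 - s)))) = 1 := by
  have h0 := (hasSum_poisson κ).sub ((hasSum_poisson_mul_inv ha hκ).mul_left a)
  have h1 := (hasSum_poisson_mul_inv (a := a + 1) (by linarith) hκ).mul_left κ
  rw [← hasSum_nat_add_iff' 1] at h0
  have hterm (k : ℕ) : κ ^ (k + 1) * exp (-κ) / (k + 1).factorial -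
      a * (κ ^ (k + 1) * exp (-κ) / (k + 1).factorial * (a + (k + 1 : ℕ))⁻¹) =
      κ * (κ ^ k * exp (-κ) / k.factorial * (a + 1 + k)⁻¹) := by
    have : a + 1 + k ≠ 0 := by positivity
    rw [Nat.factorial_succ]
    push_cast
    rw [show a + ((k : ℝ) + 1) = a + 1 + k by ring]
    field_simp
    ring
  simp only [hterm] at h0
  have h := h0.unique h1
  rw [Finset.sum_range_one, Nat.cast_zero, add_zero, mul_left_comm, mul_inv_cancel₀ ha.ne',
    mul_one, sub_self, sub_zero, add_sub_cancel_right] at h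
  linarith

theorem integral_sum_mul_div_pi_gaussianReal_eq_setIntegral {ι : Type*} [Fintype ι] (μ : ι → ℝ)
    {v : ℝ≥0} (hv : v ≠ 0) {n : ℕ} (hn : 2 * n + 1 < Fintype.card ι) {κ : ℝ}
    (hκ : κ = (∑ i, μ i ^ 2) / (2 * v)) :
    n.factorial * (2 * v) ^ n * ∫ m, (∑ i, m i * μ i) / (∑ i, m i ^ 2) ^ (n + 1)
        ∂(Measure.pi fun i => gaussianReal (μ i) v) =
      κ * ∫ s in Ioo (0 : ℝ) 1, (1 - s) ^ n *
        (s ^ ((Fintype.card ι : ℝ) / 2 - n - 1) * exp (-(κ * (1 - s)))) := by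
  have hv0 : (0 : ℝ) < v := by positivity
  rw [mul_right_comm, integral_sum_mul_div_pi_gaussianReal μ hv hn,
    setIntegral_Ioi_eq_setIntegral_Ioo (c := 2 * v) (by positivity), ← integral_mul_const,
    ← integral_const_mul]
  refine setIntegral_congr_fun measurableSet_Ioo fun s ⟨hs0, hs1⟩ => ?_
  lift s to ℝ≥0 using hs0.le
  have hs1' : 0 ≤ 1 - (s : ℝ) := by linarith
  have hroot : √(s : ℝ) ^ Fintype.card ι =
      (s : ℝ) ^ ((Fintype.card ι : ℝ) / 2 - n - 1) * (s : ℝ) ^ (n + 1) := by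
    rw [← rpow_natCast (s : ℝ) (n + 1), ← rpow_add hs0, sqrt_eq_rpow, ← rpow_mul_natCast hs0.le]
    congr 1
    push_cast
    ring
  have h := integral_sum_mul_exp_neg_mul_sum_sq_pi_gaussianReal μ (s := s) hv
    (t := (1 - s) / (2 * v * s)) (by positivity) (by field_simp; ring)
  have hexp : (1 - (s : ℝ)) / (2 * v * s) * (∑ i, μ i ^ 2) * s = κ * (1 - s) := by
    rw [hκ]
    field_simp
  rw [h, hroot, hexp, show ∑ i, μ i ^ 2 = κ * (2 * v) by rw [hκ]; field_simp, div_pow]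
  field_simp
  ring

/-- Let `ℓ ≥ 4`, `μ ∈ ℝ^ℓ`, `τ > 0`, `λ ∈ ℝ`, and `M` a random vector
in `ℝ^ℓ` with independent coordinates `M_i ~ N(μ_i, τ²)`. With `κ = ‖μ‖²/(2τ²)`,
`P(ℓ) = ∑_{k} ((ℓ−2)/(ℓ−2+2k)) κ^k e^{−κ}/k!` and
`Q(ℓ) = ∑_{k} (2κ/(ℓ−2+2k)) κ^k e^{−κ}/k!`, one has
`E[1 − M'μ/‖M‖² − λτ² M'μ/‖M‖⁴] = P(ℓ) − (λ/2)(P(ℓ) + Q(ℓ) − 1)`,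
where `M'μ = ∑ M_i μ_i`, `‖M‖² = ∑ M_i²` and `‖M‖⁴ = (∑ M_i²)²`. -/
theorem gaussian_bias_formula (ℓ : ℕ) (hℓ : 4 ≤ ℓ)
    (μ : Fin ℓ → ℝ) (τ lam : ℝ) (hτ : 0 < τ)
    (κ P Q : ℝ) (hκ : κ = (∑ i, μ i ^ 2) / (2 * τ ^ 2))
    (hP : P = ∑' k : ℕ, (((ℓ : ℝ) - 2) / ((ℓ : ℝ) - 2 + 2 * k))
        * (κ ^ k * Real.exp (-κ) / (Nat.factorial k)))
    (hQ : Q = ∑' k : ℕ, (2 * κ / ((ℓ : ℝ) - 2 + 2 * k))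
        * (κ ^ k * Real.exp (-κ) / (Nat.factorial k))) :
    (∫ m, (1 - (∑ i, m i * μ i) / (∑ i, m i ^ 2)
          - lam * τ ^ 2 * ((∑ i, m i * μ i) / (∑ i, m i ^ 2) ^ 2))
        ∂(gaussianVecLaw ℓ μ τ))
      = P - lam / 2 * (P + Q - 1) := by
  unfold gaussianVecLaw
  obtain ⟨v, hv⟩ : ∃ v : ℝ≥0, (τ ^ 2).toNNReal = v := ⟨_, rfl⟩
  have hvτ : (v : ℝ) = τ ^ 2 := by rw [← hv, coe_toNNReal _ (sq_nonneg τ)]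
  have hv0 : v ≠ 0 := by rw [← NNReal.coe_ne_zero, hvτ]; positivity
  have hκ0 : 0 ≤ κ := by rw [hκ]; positivity
  have hℓ' : (4 : ℝ) ≤ ℓ := mod_cast hℓ
  rw [hv]
  rw [← hvτ] at hκ ⊢
  have ha : (0 : ℝ) < ℓ / 2 - 1 := by linarith
  set R := ∫ s in Ioo (0 : ℝ) 1, s ^ ((ℓ : ℝ) / 2 - 1 - 1) * exp (-(κ * (1 - s))) with hR
  set R' := ∫ s in Ioo (0 : ℝ) 1, s ^ ((ℓ : ℝ) / 2 - 1) * exp (-(κ * (1 - s))) with hR'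
  have hsum : HasSum _ R := hasSum_poisson_mul_inv ha hκ0
  have hden (k : ℕ) : (ℓ : ℝ) - 2 + 2 * k = 2 * (ℓ / 2 - 1 + k) := by ring
  have hPR : P = (ℓ / 2 - 1) * R := by
    rw [hP, ← (hsum.mul_left _).tsum_eq]
    refine tsum_congr fun k => ?_
    have : (ℓ : ℝ) / 2 - 1 + k ≠ 0 := by positivity
    rw [hden]
    field_simp
  have hQR : Q = κ * R := by
    rw [hQ, ← (hsum.mul_left _).tsum_eq]
    refine tsum_congr fun k => ?_
    have : (ℓ : ℝ) / 2 - 1 + k ≠ 0 := by positivity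
    rw [hden]
    field_simp
  have hrec : (ℓ / 2 - 1) * R + κ * R' = 1 := poisson_inv_recurrence ha hκ0
  have hn0 : 2 * 0 + 1 < Fintype.card (Fin ℓ) := by simp; omega
  have hn1 : 2 * 1 + 1 < Fintype.card (Fin ℓ) := by simp; omega
  have hint0 := integrable_sum_mul_div_pi_gaussianReal μ hv0 hn0
  have hint1 := integrable_sum_mul_div_pi_gaussianReal μ hv0 hn1
  have h0 := integral_sum_mul_div_pi_gaussianReal_eq_setIntegral μ hv0 hn0 hκ
  have h1 := integral_sum_mul_div_pi_gaussianReal_eq_setIntegral μ hv0 hn1 hκ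
  simp only [zero_add, pow_one, pow_zero, one_mul, Nat.factorial, Nat.cast_one, Nat.cast_zero,
    sub_zero, Fintype.card_fin, mul_one, one_add_one_eq_two] at hint0 hint1 h0 h1
  have hdiff : ∫ s in Ioo (0 : ℝ) 1, (1 - s) *
      (s ^ ((ℓ : ℝ) / 2 - 1 - 1) * exp (-(κ * (1 - s)))) = R - R' := by
    rw [hR, hR', ← integral_sub (integrableOn_rpow_mul_exp ha κ)
      (integrableOn_rpow_mul_exp (by linarith) κ)]
    refine setIntegral_congr_fun measurableSet_Ioo fun s hs => ?_
    rw [rpow_sub_one hs.1.ne' ((ℓ : ℝ) / 2 - 1)]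
    have := hs.1.ne'
    field_simp
  rw [hdiff] at h1
  rw [integral_sub (by exact (integrable_const _).sub hint0) (hint1.const_mul _),
    integral_sub (integrable_const _) hint0, integral_const_mul, h0]
  simp only [integral_const, probReal_univ, smul_eq_mul, mul_one]
  rw [hPR, hQR]
  linear_combination (lam / 2 - 1) * hrec - lam / 2 * h1
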